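/- arXiv:2105.05138 — 4 statements merged into one kernel-verified Lean document; each statement's English description precedes it below -/
import Mathlib

section
/- Suppose f : {0,1}^p → {0,1} is non-constant and condition κ4 fails. Then the family of vectors (c_1,…,c_{p+1}) is linearly independent in ℝ^({0,1}^p); in particular, c_{p+1} does not lie in the linear span of {c_1,…,c_p}. -/
/-- A judgement on `p` premises: a vector in `{0,1}^p`, encoded as `Fin p → Bool`. -/
abbrev Judg (p : ℕ) : Type := Fin p → Bool

noncomputable section

/-- `Ω_i`: for a premise index `i < p`, the set of judgements whose `i`-th premise is `1`;
for the conclusion index `i = p`, the set of judgements `ω` with `f ω = 1`. -/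
def Omega (p : ℕ) (f : Judg p → Bool) (i : Fin (p + 1)) : Finset (Judg p) :=
  if h : (i : ℕ) < p then Finset.univ.filter (fun ω => ω ⟨(i : ℕ), h⟩ = true)
  else Finset.univ.filter (fun ω => f ω = true)

/-- The vector `c_i ∈ ℝ^({0,1}^p)`: `c_i(ω) = q_i - 1` if `ω ∈ Ω_i`, else `q_i`. -/
def cvec (p : ℕ) (f : Judg p → Bool) (q : Fin (p + 1) → ℝ) (i : Fin (p + 1)) :
    Judg p → ℝ :=
  fun ω => if ω ∈ Omega p f i then q i - 1 else q i

/-- Euclidean inner product on `ℝ^({0,1}^p)`. -/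
def inn (p : ℕ) (u v : Judg p → ℝ) : ℝ := ∑ ω : Judg p, u ω * v ω

/-- The histogram of a profile: how many agents cast each judgement. -/
def Hist (p n : ℕ) (P : Fin n → Judg p) (ω : Judg p) : ℕ :=
  (Finset.univ.filter (fun j => P j = ω)).card

/-- The histogram, viewed as a vector in `ℝ^({0,1}^p)`. -/
def HistR (p n : ℕ) (P : Fin n → Judg p) : Judg p → ℝ :=
  fun ω => (Hist p n P ω : ℝ)

/-- `n_i(P)`: the number of agents of `P` whose judgement lies in `Ω_i`. -/
def nOnes (p n : ℕ) (f : Judg p → Bool) (P : Fin n → Judg p) (i : Fin (p + 1)) : ℕ :=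
  ∑ ω ∈ Omega p f i, Hist p n P ω

/-- The quota rule on profiles, with thresholds `q` and tie-breakings `d`. -/
def quota (p n : ℕ) (f : Judg p → Bool) (q : Fin (p + 1) → ℝ) (d : Fin (p + 1) → Bool)
    (P : Fin n → Judg p) (i : Fin (p + 1)) : Bool := by
  classical
  exact if (nOnes p n f P i : ℝ) > q i * (n : ℝ) then true
    else if (nOnes p n f P i : ℝ) = q i * (n : ℝ) then d i
    else false

/-- The real value of a bit: `1` for `1`/true, `0` for `0`/false. -/
def bval (b : Bool) : ℝ := if b then 1 else 0

/-- `sign(1) = 1` and `sign(0) = -1`. -/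
def sgn (b : Bool) : ℝ := if b then 1 else -1

/-- `α ∈ {0,1}^{p+1}` is consistent if its conclusion component equals `f` applied to
its premise components. -/
def Consistent (p : ℕ) (f : Judg p → Bool) (α : Fin (p + 1) → Bool) : Prop :=
  α (Fin.last p) = f (fun j => α j.castSucc)

/-- A profile is a doctrinal paradox if the quota-rule output is inconsistent. -/
def Paradox (p n : ℕ) (f : Judg p → Bool) (q : Fin (p + 1) → ℝ) (d : Fin (p + 1) → Bool)
    (P : Fin n → Judg p) : Prop :=
  ¬ Consistent p f (quota p n f q d P)

/-- The polyhedron `H_α`. -/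
def polyH (p : ℕ) (f : Judg p → Bool) (q : Fin (p + 1) → ℝ) (d : Fin (p + 1) → Bool)
    (α : Fin (p + 1) → Bool) : Set (Judg p → ℝ) :=
  {x | ∀ i : Fin (p + 1),
    sgn (α i) * inn p (cvec p f q i) x ≤ sgn (α i) * bval (d i) - bval (α i)}

/-- The characteristic cone `H_{α,≤0}`. -/
def coneH (p : ℕ) (f : Judg p → Bool) (q : Fin (p + 1) → ℝ)
    (α : Fin (p + 1) → Bool) : Set (Judg p → ℝ) :=
  {x | ∀ i : Fin (p + 1), sgn (α i) * inn p (cvec p f q i) x ≤ 0}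

/-- A probability distribution on `{0,1}^p`. -/
def IsDistribution (p : ℕ) (π : Judg p → ℝ) : Prop :=
  (∀ ω, 0 ≤ π ω) ∧ ∑ ω : Judg p, π ω = 1

/-- `pr_i(π) = Σ_{ω ∈ Ω_i} π(ω)`. -/
def pr (p : ℕ) (f : Judg p → Bool) (π : Judg p → ℝ) (i : Fin (p + 1)) : ℝ :=
  ∑ ω ∈ Omega p f i, π ω

/-- The quota rule applied to a distribution. -/
def quotaDist (p : ℕ) (f : Judg p → Bool) (q : Fin (p + 1) → ℝ) (d : Fin (p + 1) → Bool)
    (π : Judg p → ℝ) (i : Fin (p + 1)) : Bool := by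
  classical
  exact if pr p f π i > q i then true
    else if pr p f π i = q i then d i
    else false

/-- `α` is a refinement of `π`: it matches `r(π)` on every non-tied proposition. -/
def Refines (p : ℕ) (f : Judg p → Bool) (q : Fin (p + 1) → ℝ) (d : Fin (p + 1) → Bool)
    (π : Judg p → ℝ) (α : Fin (p + 1) → Bool) : Prop :=
  ∀ i : Fin (p + 1), pr p f π i ≠ q i → α i = quotaDist p f q d π i

/-- `α` is an effective refinement of `π` at `n`: a refinement realized by some profile. -/
def EffRef (p n : ℕ) (f : Judg p → Bool) (q : Fin (p + 1) → ℝ) (d : Fin (p + 1) → Bool)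
    (π : Judg p → ℝ) (α : Fin (p + 1) → Bool) : Prop :=
  Refines p f q d π α ∧ ∃ P : Fin n → Judg p, quota p n f q d P = α

/-- The probability that a random profile drawn from the independent (non-identical)
product of `vπ` is a doctrinal paradox. -/
def probParadox (p n : ℕ) (f : Judg p → Bool) (q : Fin (p + 1) → ℝ)
    (d : Fin (p + 1) → Bool) (vπ : Fin n → Judg p → ℝ) : ℝ := by
  classical
  exact ∑ P : Fin n → Judg p,
    if Paradox p n f q d P then ∏ j : Fin n, vπ j (P j) else 0

/-- The max-smoothed likelihood of the doctrinal paradox. -/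
def DPmax (p n : ℕ) (f : Judg p → Bool) (q : Fin (p + 1) → ℝ) (d : Fin (p + 1) → Bool)
    (D : Set (Judg p → ℝ)) : ℝ :=
  sSup {x : ℝ | ∃ vπ : Fin n → Judg p → ℝ,
    (∀ j, vπ j ∈ D) ∧ x = probParadox p n f q d vπ}

/-- The min-smoothed likelihood of the doctrinal paradox. -/
def DPmin (p n : ℕ) (f : Judg p → Bool) (q : Fin (p + 1) → ℝ) (d : Fin (p + 1) → Bool)
    (D : Set (Judg p → ℝ)) : ℝ :=
  sInf {x : ℝ | ∃ vπ : Fin n → Judg p → ℝ,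
    (∀ j, vπ j ∈ D) ∧ x = probParadox p n f q d vπ}

/-- Condition `κ1(n)`: no profile of `n` agents is a doctrinal paradox. -/
def kappa1 (p n : ℕ) (f : Judg p → Bool) (q : Fin (p + 1) → ℝ)
    (d : Fin (p + 1) → Bool) : Prop :=
  ∀ P : Fin n → Judg p, ¬ Paradox p n f q d P

/-- Condition `κ2(n)`: every effective refinement at `n` of every `π` in the convex hull
of `D` is consistent. -/
def kappa2 (p n : ℕ) (f : Judg p → Bool) (q : Fin (p + 1) → ℝ) (d : Fin (p + 1) → Bool)
    (D : Set (Judg p → ℝ)) : Prop :=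
  ∀ π ∈ convexHull ℝ D, ∀ α : Fin (p + 1) → Bool,
    EffRef p n f q d π α → Consistent p f α

/-- Condition `κ3(n)`: some `π` in the convex hull of `D` has all its effective
refinements at `n` consistent. -/
def kappa3 (p n : ℕ) (f : Judg p → Bool) (q : Fin (p + 1) → ℝ) (d : Fin (p + 1) → Bool)
    (D : Set (Judg p → ℝ)) : Prop :=
  ∃ π ∈ convexHull ℝ D, ∀ α : Fin (p + 1) → Bool,
    EffRef p n f q d π α → Consistent p f α

/-- Condition `κ4`: the conclusion depends on exactly one premise, with matching
thresholds. -/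
def kappa4 (p : ℕ) (f : Judg p → Bool) (q : Fin (p + 1) → ℝ) : Prop :=
  ∃ i : Fin p,
    ((∀ ω : Judg p, f ω = ω i) ∧ q (Fin.last p) = q i.castSucc) ∨
    ((∀ ω : Judg p, f ω = !(ω i)) ∧ q (Fin.last p) = 1 - q i.castSucc)

/-- `D` is strictly positive: some `ε > 0` lower-bounds every probability. -/
def StrictlyPositive (p : ℕ) (D : Set (Judg p → ℝ)) : Prop :=
  ∃ ε > (0 : ℝ), ∀ π ∈ D, ∀ ω : Judg p, ε ≤ π ω

theorem cvec_castSucc (p : ℕ) (f : Judg p → Bool) (q : Fin (p + 1) → ℝ) (i : Fin p)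
    (ω : Judg p) : cvec p f q i.castSucc ω = q i.castSucc - bval (ω i) := by
  cases h : ω i <;> simp [cvec, Omega, bval, h]

theorem cvec_last (p : ℕ) (f : Judg p → Bool) (q : Fin (p + 1) → ℝ)
    (ω : Judg p) : cvec p f q (Fin.last p) ω = q (Fin.last p) - bval (f ω) := by
  cases h : f ω <;> simp [cvec, Omega, bval, h]

/-- In a vanishing affine relation between the bits of `ω` and `f ω`, the coefficient of a bit
is determined by the effect of flipping that bit. -/
theorem coeff_add_mul_flip_eq_zero {p : ℕ} {f : Judg p → Bool} {a r : Fin p → ℝ} {b s : ℝ}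
    (h : ∀ ω : Judg p, ∑ i, a i * (r i - bval (ω i)) + b * (s - bval (f ω)) = 0)
    (ω : Judg p) (i : Fin p) :
    a i + b * (bval (f (Function.update ω i true)) - bval (f (Function.update ω i false))) = 0 := by
  have h1 := h (Function.update ω i true)
  have h0 := h (Function.update ω i false)
  have hd : ∑ j, a j * (r j - bval (Function.update ω i false j)) -
      ∑ j, a j * (r j - bval (Function.update ω i true j)) = a i := by
    rw [← Finset.sum_sub_distrib, Finset.sum_eq_single i]
    · simp [bval]; ring
    · intro j _ hj
      simp [hj]
    · simp
  linarith

theorem affine_relation_trivial {p : ℕ} {f : Judg p → Bool} {q : Fin (p + 1) → ℝ}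
    (hnc : ∃ ω₁ ω₂ : Judg p, f ω₁ ≠ f ω₂) (hk4 : ¬ kappa4 p f q) {a : Fin p → ℝ} {b : ℝ}
    (h : ∀ ω : Judg p, ∑ i, a i * (q i.castSucc - bval (ω i)) +
      b * (q (Fin.last p) - bval (f ω)) = 0) :
    (∀ i, a i = 0) ∧ b = 0 := by
  have key := coeff_add_mul_flip_eq_zero h
  obtain ⟨ω₁, ω₂, hne⟩ := hnc
  by_cases hb : b = 0
  · refine ⟨fun i => ?_, hb⟩
    simpa [hb] using key ω₁ i
  exfalso
  have hex : ∃ i, a i ≠ 0 := by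
    by_contra! ha
    have e1 := h ω₁
    have e2 := h ω₂
    simp only [ha, zero_mul, Finset.sum_const_zero, zero_add, mul_eq_zero, hb, false_or] at e1 e2
    have e : bval (f ω₁) = bval (f ω₂) := by linarith
    cases h1 : f ω₁ <;> cases h2 : f ω₂ <;> simp_all [bval]
  obtain ⟨i, hi⟩ := hex
  have single (g : Bool → Bool) (hf : ∀ ω, f ω = g (ω i)) (ω : Judg p) :
      a i * (q i.castSucc - bval (ω i)) + b * (q (Fin.last p) - bval (f ω)) = 0 := by
    have e := h ω
    rwa [Finset.sum_eq_single i] at e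
    · intro j _ hj
      have := key ω j
      simp only [hf, Function.update_of_ne hj.symm, sub_self, mul_zero, add_zero] at this
      rw [this, zero_mul]
    · simp
  have flip (ω : Judg p) :
      (a i = -b ∧ f (Function.update ω i true) = true ∧ f (Function.update ω i false) = false) ∨
      (a i = b ∧ f (Function.update ω i true) = false ∧ f (Function.update ω i false) = true) := by
    have e := key ω i
    cases h1 : f (Function.update ω i true) <;> cases h0 : f (Function.update ω i false) <;>
      simp only [h1, h0, bval, if_true, Bool.false_eq_true, if_false, sub_self, mul_zero,
        add_zero] at e
    · exact absurd e hi
    · exact Or.inr ⟨by linarith, rfl, rfl⟩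
    · exact Or.inl ⟨by linarith, rfl, rfl⟩
    · exact absurd e hi
  have hbb : b ≠ -b := fun e => hb (by linarith)
  apply hk4
  rcases flip ω₁ with ⟨hab, -, -⟩ | ⟨hab, -, -⟩
  · have hf : ∀ ω, f ω = ω i := by
      intro ω
      rcases flip ω with ⟨-, h1, h0⟩ | ⟨hab', -, -⟩
      · have hu := Function.update_eq_self i ω
        cases hω : ω i <;> rw [hω] at hu
        · rwa [hu] at h0
        · rwa [hu] at h1
      · exact absurd (hab'.symm.trans hab) hbb
    refine ⟨i, Or.inl ⟨hf, ?_⟩⟩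
    have e := single id hf ω₁
    rw [hab, hf] at e
    exact mul_left_cancel₀ hb (by linarith)
  · have hf : ∀ ω, f ω = !(ω i) := by
      intro ω
      rcases flip ω with ⟨hab', -, -⟩ | ⟨-, h1, h0⟩
      · exact absurd (hab.symm.trans hab') hbb
      · have hu := Function.update_eq_self i ω
        cases hω : ω i <;> rw [hω] at hu
        · rwa [hu] at h0
        · rwa [hu] at h1
    refine ⟨i, Or.inr ⟨hf, ?_⟩⟩
    have e := single (fun x => !x) hf ω₁
    have hn : bval (!(ω₁ i)) = 1 - bval (ω₁ i) := by cases ω₁ i <;> simp [bval]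
    rw [hab, hf, hn] at e
    exact mul_left_cancel₀ hb (by linarith)

theorem linearIndependent_cvec {p : ℕ} {f : Judg p → Bool} {q : Fin (p + 1) → ℝ}
    (hnc : ∃ ω₁ ω₂ : Judg p, f ω₁ ≠ f ω₂) (hk4 : ¬ kappa4 p f q) :
    LinearIndependent ℝ (cvec p f q) := by
  rw [Fintype.linearIndependent_iff]
  intro g hg
  obtain ⟨ha, hb⟩ := affine_relation_trivial (a := fun i => g i.castSucc)
    (b := g (Fin.last p)) hnc hk4 fun ω => by
      simpa [Fin.sum_univ_castSucc, cvec_castSucc, cvec_last] using congrFun hg ω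
  exact Fin.lastCases hb ha

/-- if `f` is non-constant and κ4 fails, then `(c_1,…,c_{p+1})` is linearly
independent; in particular `c_{p+1}` is not in the span of `{c_1,…,c_p}`. -/
theorem stmt_8 (p : ℕ) (hp : 1 ≤ p) (f : Judg p → Bool)
    (q : Fin (p + 1) → ℝ) (hq : ∀ i, q i ∈ Set.Icc (0 : ℝ) 1)
    (hnc : ∃ ω₁ ω₂ : Judg p, f ω₁ ≠ f ω₂) (hk4 : ¬ kappa4 p f q) :
    LinearIndependent ℝ (cvec p f q) ∧
      cvec p f q (Fin.last p) ∉
        Submodule.span ℝ (Set.range fun i : Fin p => cvec p f q i.castSucc) := by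
  have hli := linearIndependent_cvec hnc hk4
  refine ⟨hli, fun hmem => hli.notMem_span_image (s := Set.range Fin.castSucc)
    (x := Fin.last p) ?_ ?_⟩
  · rintro ⟨i, hi⟩
    exact Fin.castSucc_ne_last i hi
  · rwa [← Set.range_comp]

end
end

section
/- Let n ≥ 1 and suppose q_i·n is an integer for every i ∈ {1,…,p+1}. For every distribution π on {0,1}^p and every α ∈ {0,1}^{p+1}, the polyhedron H_α is active at (π, n) — meaning that π ∈ H_{α,≤0} and there exists a profile P of n agents with Hist(P) ∈ H_α — if and only if α is an effective refinement of π at n. -/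
noncomputable section

/-- The inner product with `c_i` measures how far the mass of `Ω_i` falls short of the quota. -/
theorem inn_cvec (p : ℕ) (f : Judg p → Bool) (q : Fin (p + 1) → ℝ) (i : Fin (p + 1))
    (x : Judg p → ℝ) :
    inn p (cvec p f q i) x = q i * ∑ ω, x ω - ∑ ω ∈ Omega p f i, x ω := by
  have h : ∑ ω ∈ Omega p f i, x ω = ∑ ω, if ω ∈ Omega p f i then x ω else 0 := by
    simp
  rw [h, inn, Finset.mul_sum, ← Finset.sum_sub_distrib]
  refine Finset.sum_congr rfl fun ω _ => ?_
  unfold cvec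
  split_ifs <;> ring

theorem sum_Hist (p n : ℕ) (P : Fin n → Judg p) : ∑ ω, Hist p n P ω = n := by
  simpa [Hist] using
    (Finset.card_eq_sum_card_fiberwise (s := Finset.univ) (t := Finset.univ) (f := P)
      (fun _ _ => Finset.mem_coe.2 (Finset.mem_univ _))).symm

theorem inn_cvec_HistR (p n : ℕ) (f : Judg p → Bool) (q : Fin (p + 1) → ℝ) (i : Fin (p + 1))
    (P : Fin n → Judg p) :
    inn p (cvec p f q i) (HistR p n P) = q i * n - nOnes p n f P i := by
  have h : ∑ ω, HistR p n P ω = n := by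
    unfold HistR
    exact_mod_cast sum_Hist p n P
  rw [inn_cvec, h]
  simp [nOnes, HistR]

/-- With an integral quota, the inequality of `H_α` at a histogram says that the quota rule
outputs `α`. -/
theorem HistR_ineq_iff (p n : ℕ) (f : Judg p → Bool) (q : Fin (p + 1) → ℝ)
    (d : Fin (p + 1) → Bool) (i : Fin (p + 1)) (hint : ∃ k : ℤ, q i * (n : ℝ) = (k : ℝ))
    (P : Fin n → Judg p) (b : Bool) :
    sgn b * inn p (cvec p f q i) (HistR p n P) ≤ sgn b * bval (d i) - bval b ↔
      quota p n f q d P i = b := by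
  obtain ⟨k, hk⟩ := hint
  rw [inn_cvec_HistR]
  unfold quota
  rw [hk]
  generalize nOnes p n f P i = m
  have hgt : (m : ℝ) > k ↔ (k : ℤ) < m := by exact_mod_cast Iff.rfl
  have heq : (m : ℝ) = k ↔ (m : ℤ) = k := by exact_mod_cast Iff.rfl
  simp only [hgt, heq]
  have hcast : sgn b * ((k : ℝ) - m) ≤ sgn b * bval (d i) - bval b ↔
      (if b then 1 else -1) * (k - (m : ℤ)) ≤
        (if b then 1 else -1) * (if d i then 1 else 0) - (if b then 1 else 0) := by
    rw [← Int.cast_le (R := ℝ)]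
    unfold sgn bval
    push_cast
    rfl
  rw [hcast]
  cases b <;> cases d i <;> simp <;> omega

theorem mem_coneH_iff_Refines (p : ℕ) (f : Judg p → Bool) (q : Fin (p + 1) → ℝ)
    (d : Fin (p + 1) → Bool) (π : Judg p → ℝ) (hπ : ∑ ω, π ω = 1) (α : Fin (p + 1) → Bool) :
    π ∈ coneH p f q α ↔ Refines p f q d π α := by
  refine forall_congr' fun i => ?_
  rw [inn_cvec, hπ, mul_one]
  change sgn (α i) * (q i - pr p f π i) ≤ 0 ↔ _
  unfold quotaDist sgn
  rcases lt_trichotomy (pr p f π i) (q i) with h | h | h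
  · cases α i <;> simp [h, h.ne, h.not_gt, h.le]
  · simp [h]
  · cases α i <;> simp [h, h.ne', h.not_ge, h.le]

/-- when every `q_i·n` is an integer, `H_α` is active at `(π, n)` iff `α` is
an effective refinement of `π` at `n`. -/
theorem stmt_9 (p : ℕ) (hp : 1 ≤ p) (f : Judg p → Bool)
    (q : Fin (p + 1) → ℝ) (hq : ∀ i, q i ∈ Set.Icc (0 : ℝ) 1)
    (d : Fin (p + 1) → Bool) (n : ℕ) (hn : 1 ≤ n)
    (hint : ∀ i : Fin (p + 1), ∃ k : ℤ, q i * (n : ℝ) = (k : ℝ))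
    (π : Judg p → ℝ) (hπ : IsDistribution p π) (α : Fin (p + 1) → Bool) :
    (π ∈ coneH p f q α ∧ ∃ P : Fin n → Judg p, HistR p n P ∈ polyH p f q d α) ↔
      EffRef p n f q d π α := by
  refine and_congr (mem_coneH_iff_Refines p f q d π hπ.2 α) (exists_congr fun P => ?_)
  rw [funext_iff]
  exact forall_congr' fun i => HistR_ineq_iff p n f q d i (hint i) P (α i)

end
end

section
/- Let Π be a closed and strictly positive set of distributions on {0,1}^p, let r be a quota rule and f a logical connection. There exist constants C > 0 and c > 0, depending only on Π, q, d, and f, such that for every n ≥ 1 for which condition κ2(n) holds, DP^max(n) ≤ C·exp(−c·n). -/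
noncomputable section

/-- In finite dimension, the convex hull of a compact set is compact (by Carathéodory). -/
theorem IsCompact.convexHull_of_finiteDimensional {E : Type*} [AddCommGroup E] [Module ℝ E]
    [TopologicalSpace E] [ContinuousAdd E] [ContinuousSMul ℝ E] [FiniteDimensional ℝ E]
    {s : Set E} (hs : IsCompact s) : IsCompact (convexHull ℝ s) := by
  let K : ℕ → Set E := fun m =>
    (fun x : (Fin m → ℝ) × (Fin m → E) => ∑ i, x.1 i • x.2 i) ''
      (stdSimplex ℝ (Fin m) ×ˢ Set.univ.pi fun _ => s)
  have hK : ∀ m, IsCompact (K m) := fun m =>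
    ((isCompact_stdSimplex ℝ (Fin m)).prod (isCompact_univ_pi fun _ => hs)).image (by fun_prop)
  have hunion : convexHull ℝ s = ⋃ m ∈ Set.Iic (Module.finrank ℝ E + 1), K m := by
    apply Set.Subset.antisymm
    · intro x hx
      obtain ⟨ι, _, z, w, hz, hind, hw, hw1, hsum⟩ := eq_pos_convex_span_of_mem_convexHull hx
      simp only [Set.mem_iUnion]
      let e := Fintype.equivFin ι
      refine ⟨Fintype.card ι, ?_, (w ∘ e.symm, z ∘ e.symm), ⟨⟨fun i => (hw _).le, ?_⟩, ?_⟩, ?_⟩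
      · exact hind.card_le_finrank_succ.trans
          (Nat.add_le_add_right (Submodule.finrank_le _) 1)
      · rw [← hw1]
        exact Equiv.sum_comp e.symm w
      · exact fun i _ => hz ⟨_, rfl⟩
      · rw [← hsum]
        exact Equiv.sum_comp e.symm fun i => w i • z i
    · simp only [Set.iUnion_subset_iff]
      rintro m - _ ⟨⟨w, z⟩, ⟨⟨hw, hw1⟩, hz⟩, rfl⟩
      exact (convex_convexHull ℝ s).sum_mem (fun i _ => hw i) hw1
        fun i _ => subset_convexHull ℝ s (hz i trivial)
  rw [hunion]
  exact (Set.finite_Iic _).isCompact_biUnion fun m _ => hK m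

/-- The number of agents voting in `Ω_i`, as a sum of indicators over the agents. -/
theorem nOnes_eq_sum (p n : ℕ) (f : Judg p → Bool) (P : Fin n → Judg p) (i : Fin (p + 1)) :
    (nOnes p n f P i : ℝ) = ∑ j, if P j ∈ Omega p f i then (1 : ℝ) else 0 := by
  have h : nOnes p n f P i = (Finset.univ.filter fun j => P j ∈ Omega p f i).card := by
    have hmaps : ∀ j ∈ Finset.univ.filter fun j => P j ∈ Omega p f i, P j ∈ Omega p f i :=
      fun j hj => (Finset.mem_filter.1 hj).2
    rw [Finset.card_eq_sum_card_fiberwise (t := Omega p f i) (f := P) hmaps]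
    refine Finset.sum_congr rfl fun ω hω => ?_
    rw [Hist, Finset.filter_filter]
    congr 1
    ext j
    simp only [Finset.mem_filter, Finset.mem_univ, true_and]
    exact ⟨fun h => ⟨h ▸ hω, h⟩, fun h => h.2⟩
  rw [h, Finset.sum_boole]

theorem IsDistribution.pr_mem_Icc {p : ℕ} {f : Judg p → Bool} {π : Judg p → ℝ}
    (h : IsDistribution p π) (i : Fin (p + 1)) : pr p f π i ∈ Set.Icc (0 : ℝ) 1 :=
  ⟨Finset.sum_nonneg fun ω _ => h.1 ω, h.2 ▸
    Finset.sum_le_sum_of_subset_of_nonneg (Finset.subset_univ _) fun ω _ _ => h.1 ω⟩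

/-- A bound on the moment generating function of a centred indicator. -/
theorem IsDistribution.sum_mul_exp_le {p : ℕ} {f : Judg p → Bool} {π : Judg p → ℝ}
    (h : IsDistribution p π) (i : Fin (p + 1)) {t : ℝ} (ht : |t| ≤ 1) :
    ∑ ω, π ω * Real.exp (t * ((if ω ∈ Omega p f i then 1 else 0) - pr p f π i)) ≤
      Real.exp (t ^ 2) := by
  obtain ⟨h0, h1⟩ := h.pr_mem_Icc (f := f) i
  have hb : ∀ ω, Real.exp (t * ((if ω ∈ Omega p f i then 1 else 0) - pr p f π i)) ≤
      1 + t ^ 2 + t * ((if ω ∈ Omega p f i then 1 else 0) - pr p f π i) := by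
    intro ω
    set y : ℝ := (if ω ∈ Omega p f i then 1 else 0) - pr p f π i with hy
    have hy1 : |y| ≤ 1 := by
      rw [hy, abs_le]
      split_ifs <;> constructor <;> linarith
    have hty : |t * y| ≤ 1 := by
      rw [abs_mul]
      exact mul_le_one₀ ht (abs_nonneg _) hy1
    have he := (abs_le.1 (Real.abs_exp_sub_one_sub_id_le hty)).2
    have hy2 : y ^ 2 ≤ 1 := (sq_le_one_iff_abs_le_one y).2 hy1
    have : (t * y) ^ 2 ≤ t ^ 2 := by
      rw [mul_pow]
      exact mul_le_of_le_one_right (sq_nonneg t) hy2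
    linarith
  have hpr : ∑ ω, π ω * (if ω ∈ Omega p f i then (1 : ℝ) else 0) = pr p f π i := by
    simp [pr]
  calc _ ≤ ∑ ω, π ω * (1 + t ^ 2 + t * ((if ω ∈ Omega p f i then 1 else 0) - pr p f π i)) :=
        Finset.sum_le_sum fun ω _ => mul_le_mul_of_nonneg_left (hb ω) (h.1 ω)
    _ = ∑ ω, ((1 + t ^ 2 - t * pr p f π i) * π ω +
          t * (π ω * (if ω ∈ Omega p f i then (1 : ℝ) else 0))) :=
        Finset.sum_congr rfl fun ω _ => by ring
    _ = 1 + t ^ 2 := by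
        rw [Finset.sum_add_distrib, ← Finset.mul_sum, ← Finset.mul_sum, hpr, h.2]
        ring
    _ ≤ _ := by linarith [Real.add_one_le_exp (t ^ 2)]

/-- The moment generating function bound for the centred number of agents voting in `Ω_i`. -/
theorem sum_prod_mul_exp_le {p n : ℕ} {f : Judg p → Bool} {vπ : Fin n → Judg p → ℝ}
    (h : ∀ j, IsDistribution p (vπ j)) (i : Fin (p + 1)) {t : ℝ} (ht : |t| ≤ 1) :
    ∑ P : Fin n → Judg p, (∏ j, vπ j (P j)) *
        Real.exp (t * ((nOnes p n f P i : ℝ) - ∑ j, pr p f (vπ j) i)) ≤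
      Real.exp (n * t ^ 2) := by
  calc _ = ∑ P : Fin n → Judg p, ∏ j, (vπ j (P j) *
        Real.exp (t * ((if P j ∈ Omega p f i then 1 else 0) - pr p f (vπ j) i))) := by
        refine Finset.sum_congr rfl fun P _ => ?_
        rw [Finset.prod_mul_distrib, ← Real.exp_sum, nOnes_eq_sum, ← Finset.sum_sub_distrib,
          Finset.mul_sum]
    _ = ∏ j, ∑ ω, (vπ j ω *
        Real.exp (t * ((if ω ∈ Omega p f i then 1 else 0) - pr p f (vπ j) i))) := by
        rw [Finset.prod_univ_sum, Fintype.piFinset_univ]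
    _ ≤ ∏ _j : Fin n, Real.exp (t ^ 2) :=
        Finset.prod_le_prod (fun j _ => Finset.sum_nonneg fun ω _ =>
          mul_nonneg ((h j).1 ω) (Real.exp_pos _).le) fun j _ => (h j).sum_mul_exp_le i ht
    _ = _ := by simp [Real.exp_nat_mul]

theorem sgn_mul_quota_nonneg (p n : ℕ) (f : Judg p → Bool) (q : Fin (p + 1) → ℝ)
    (d : Fin (p + 1) → Bool) (P : Fin n → Judg p) (i : Fin (p + 1)) :
    0 ≤ sgn (quota p n f q d P i) * ((nOnes p n f P i : ℝ) - q i * n) := by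
  unfold quota
  split_ifs with h1 h2
  · simp only [sgn, if_true]
    linarith
  · simp [h2]
  · simp only [sgn, Bool.false_eq_true, if_false]
    linarith

theorem refines_of_sgn_mul_nonneg {p : ℕ} {f : Judg p → Bool} {q : Fin (p + 1) → ℝ}
    {d : Fin (p + 1) → Bool} {π : Judg p → ℝ} {α : Fin (p + 1) → Bool}
    (h : ∀ i, 0 ≤ sgn (α i) * (pr p f π i - q i)) : Refines p f q d π α := by
  intro i hi
  have := h i
  unfold quotaDist
  rcases lt_or_gt_of_ne hi with hlt | hgt
  · rw [if_neg (not_lt.2 hlt.le), if_neg hi]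
    by_contra hα
    simp only [Bool.not_eq_false] at hα
    simp only [sgn, hα, if_true] at this
    linarith
  · rw [if_pos hgt]
    by_contra hα
    simp only [Bool.not_eq_true] at hα
    simp only [sgn, hα, Bool.false_eq_true, if_false] at this
    linarith

theorem continuous_pr (p : ℕ) (f : Judg p → Bool) (i : Fin (p + 1)) :
    Continuous fun π : Judg p → ℝ => pr p f π i := by
  unfold pr
  fun_prop

/-- If no distribution of a compact set is refined by `α`, then every such distribution violates
`α` in some proposition by a uniform margin. -/
theorem exists_margin {p : ℕ} (f : Judg p → Bool) (q : Fin (p + 1) → ℝ)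
    (d : Fin (p + 1) → Bool) {K : Set (Judg p → ℝ)} (hK : IsCompact K)
    (α : Fin (p + 1) → Bool) :
    ∃ δ > (0 : ℝ), (∀ π ∈ K, ¬ Refines p f q d π α) →
      ∀ π ∈ K, ∃ i, sgn (α i) * (pr p f π i - q i) ≤ -δ := by
  by_cases hα : ∀ π ∈ K, ¬ Refines p f q d π α
  swap
  · exact ⟨1, one_pos, fun h => absurd h hα⟩
  rcases K.eq_empty_or_nonempty with rfl | hne
  · exact ⟨1, one_pos, by simp⟩
  let g : (Judg p → ℝ) → ℝ := fun π =>
    Finset.univ.inf' Finset.univ_nonempty fun i => sgn (α i) * (pr p f π i - q i)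
  have hg : Continuous g := by
    refine Continuous.finset_inf'_apply _ fun i _ => ?_
    exact continuous_const.mul ((continuous_pr p f i).sub continuous_const)
  obtain ⟨π₀, hπ₀, hmax⟩ := hK.exists_isMaxOn hne hg.continuousOn
  refine ⟨-g π₀, ?_, fun _ π hπ => ?_⟩
  · by_contra hcon
    refine hα π₀ hπ₀ (refines_of_sgn_mul_nonneg fun i => ?_)
    have : g π₀ ≤ _ := Finset.inf'_le (fun i => sgn (α i) * (pr p f π₀ i - q i))
      (Finset.mem_univ i)
    linarith
  · obtain ⟨i, -, hi⟩ := Finset.exists_mem_eq_inf' Finset.univ_nonempty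
      fun i => sgn (α i) * (pr p f π i - q i)
    refine ⟨i, ?_⟩
    rw [neg_neg, ← hi]
    exact hmax hπ

/-- Exponential bound on the paradox probability when the margin `δ` separates every realizable
inconsistent output from the average distribution. -/
theorem probParadox_le {p n : ℕ} {f : Judg p → Bool} {q : Fin (p + 1) → ℝ}
    {d : Fin (p + 1) → Bool} {vπ : Fin n → Judg p → ℝ} (h : ∀ j, IsDistribution p (vπ j))
    {δ : ℝ} (hδ : 0 < δ) (hδ1 : δ ≤ 1)
    (hmargin : ∀ P : Fin n → Judg p, Paradox p n f q d P →
      ∃ i, sgn (quota p n f q d P i) * ((∑ j, pr p f (vπ j) i) - q i * n) ≤ -(n * δ)) :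
    probParadox p n f q d vπ ≤ 2 * (p + 1) * Real.exp (-(δ ^ 2 / 4) * n) := by
  classical
  have hs : ∀ b : Bool, |sgn b * (δ / 2)| ≤ 1 := by
    intro b
    rw [abs_le]
    cases b <;> simp only [sgn, Bool.false_eq_true, if_true, if_false] <;>
      constructor <;> linarith
  have hs2 : ∀ b : Bool, (sgn b * (δ / 2)) ^ 2 = δ ^ 2 / 4 := by
    intro b
    cases b <;> simp [sgn] <;> ring
  let T : Bool → Fin (p + 1) → (Fin n → Judg p) → ℝ := fun b i P =>
    Real.exp (sgn b * (δ / 2) * ((nOnes p n f P i : ℝ) - ∑ j, pr p f (vπ j) i))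
  have hind : ∀ P, Paradox p n f q d P →
      1 ≤ ∑ i, ∑ b, Real.exp (-(n * δ ^ 2 / 2)) * T b i P := by
    intro P hP
    obtain ⟨i, hi⟩ := hmargin P hP
    have hq := sgn_mul_quota_nonneg p n f q d P i
    set b := quota p n f q d P i
    have hT : ∀ b i, 0 ≤ Real.exp (-(n * δ ^ 2 / 2)) * T b i P := fun b i =>
      mul_nonneg (Real.exp_pos _).le (Real.exp_pos _).le
    calc (1 : ℝ) ≤ Real.exp (-(n * δ ^ 2 / 2)) * T b i P := by
          rw [← Real.exp_add]
          apply Real.one_le_exp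
          have : n * δ ≤ sgn b * ((nOnes p n f P i : ℝ) - ∑ j, pr p f (vπ j) i) := by linarith
          nlinarith [mul_le_mul_of_nonneg_left this hδ.le]
      _ ≤ ∑ b, Real.exp (-(n * δ ^ 2 / 2)) * T b i P :=
          Finset.single_le_sum (f := fun b => Real.exp (-(n * δ ^ 2 / 2)) * T b i P)
            (fun b _ => hT b i) (Finset.mem_univ b)
      _ ≤ _ := Finset.single_le_sum
            (f := fun i => ∑ b, Real.exp (-(n * δ ^ 2 / 2)) * T b i P)
            (fun i _ => Finset.sum_nonneg fun b _ => hT b i) (Finset.mem_univ i)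
  have hprod : ∀ P : Fin n → Judg p, 0 ≤ ∏ j, vπ j (P j) := fun P =>
    Finset.prod_nonneg fun j _ => (h j).1 _
  calc probParadox p n f q d vπ
      ≤ ∑ P : Fin n → Judg p, ∑ i, ∑ b,
          Real.exp (-(n * δ ^ 2 / 2)) * ((∏ j, vπ j (P j)) * T b i P) := by
        unfold probParadox
        refine Finset.sum_le_sum fun P _ => ?_
        have hre : ∑ i, ∑ b, Real.exp (-(n * δ ^ 2 / 2)) * ((∏ j, vπ j (P j)) * T b i P) =
            (∏ j, vπ j (P j)) * ∑ i, ∑ b, Real.exp (-(n * δ ^ 2 / 2)) * T b i P := by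
          simp only [Finset.mul_sum]
          exact Finset.sum_congr rfl fun i _ => Finset.sum_congr rfl fun b _ => by ring
        rw [hre]
        split_ifs with hP
        · exact le_mul_of_one_le_right (hprod P) (hind P hP)
        · exact mul_nonneg (hprod P) (Finset.sum_nonneg fun i _ => Finset.sum_nonneg fun b _ =>
            mul_nonneg (Real.exp_pos _).le (Real.exp_pos _).le)
    _ = ∑ i, ∑ b, Real.exp (-(n * δ ^ 2 / 2)) *
          ∑ P : Fin n → Judg p, (∏ j, vπ j (P j)) * T b i P := by
        rw [Finset.sum_comm]
        refine Finset.sum_congr rfl fun i _ => ?_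
        rw [Finset.sum_comm]
        exact Finset.sum_congr rfl fun b _ => (Finset.mul_sum _ _ _).symm
    _ ≤ ∑ _i : Fin (p + 1), ∑ _b : Bool, Real.exp (-(δ ^ 2 / 4) * n) := by
        refine Finset.sum_le_sum fun i _ => Finset.sum_le_sum fun b _ => ?_
        refine (mul_le_mul_of_nonneg_left (sum_prod_mul_exp_le h i (hs b))
          (Real.exp_pos _).le).trans ?_
        rw [← Real.exp_add, hs2]
        apply Real.exp_le_exp.2
        linarith
    _ = _ := by
        simp
        ring

theorem isCompact_of_isClosed_of_isDistribution {p : ℕ} {D : Set (Judg p → ℝ)}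
    (hcl : IsClosed D) (hdist : ∀ π ∈ D, IsDistribution p π) : IsCompact D :=
  (isCompact_stdSimplex ℝ (Judg p)).of_isClosed_subset hcl fun π hπ => hdist π hπ

/-- The average of `n ≥ 1` points of `D` lies in the convex hull of `D`, and its marginals are the
averages of the marginals. -/
theorem exists_average_mem_convexHull {p n : ℕ} (f : Judg p → Bool) (hn : 1 ≤ n)
    {D : Set (Judg p → ℝ)} {vπ : Fin n → Judg p → ℝ} (h : ∀ j, vπ j ∈ D) :
    ∃ π ∈ convexHull ℝ D, ∀ i, ∑ j, pr p f (vπ j) i = pr p f π i * n := by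
  have hn0 : (n : ℝ) ≠ 0 := by positivity
  refine ⟨∑ j, (n : ℝ)⁻¹ • vπ j, ?_, fun i => ?_⟩
  · refine (convex_convexHull ℝ D).sum_mem (fun _ _ => by positivity) ?_
      fun j _ => subset_convexHull ℝ D (h j)
    simp [hn0]
  · simp only [pr, Finset.sum_apply, Pi.smul_apply, smul_eq_mul]
    rw [Finset.sum_comm, Finset.sum_mul]
    refine Finset.sum_congr rfl fun ω _ => ?_
    rw [← Finset.mul_sum]
    field_simp

/-- there are constants `C, c > 0` such that whenever κ2(n) holds,
`DP^max(n) ≤ C·exp(−c·n)`. -/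
theorem stmt_12 (p : ℕ) (hp : 1 ≤ p) (f : Judg p → Bool)
    (q : Fin (p + 1) → ℝ) (hq : ∀ i, q i ∈ Set.Icc (0 : ℝ) 1)
    (d : Fin (p + 1) → Bool) (D : Set (Judg p → ℝ)) (hne : D.Nonempty)
    (hcl : IsClosed D) (hsp : StrictlyPositive p D)
    (hdist : ∀ π ∈ D, IsDistribution p π) :
    ∃ C > (0 : ℝ), ∃ c > (0 : ℝ), ∀ n : ℕ, 1 ≤ n → kappa2 p n f q d D →
      DPmax p n f q d D ≤ C * Real.exp (-c * (n : ℝ)) := by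
  have hK := (isCompact_of_isClosed_of_isDistribution hcl hdist).convexHull_of_finiteDimensional
  choose δ hδ hmargin using exists_margin f q d hK
  let η : ℝ := min 1 (Finset.univ.inf' Finset.univ_nonempty δ)
  have hη : 0 < η := lt_min one_pos ((Finset.lt_inf'_iff _).2 fun α _ => hδ α)
  have hηδ : ∀ α, η ≤ δ α := fun α =>
    (min_le_right _ _).trans (Finset.inf'_le _ (Finset.mem_univ α))
  refine ⟨2 * (p + 1), by positivity, η ^ 2 / 4, by positivity, fun n hn hκ => ?_⟩
  refine Real.sSup_le ?_ (by positivity)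
  rintro _ ⟨vπ, hvπ, rfl⟩
  refine probParadox_le (fun j => hdist _ (hvπ j)) hη (min_le_left _ _) fun P hP => ?_
  obtain ⟨π, hπ, hpr⟩ := exists_average_mem_convexHull f hn hvπ
  obtain ⟨i, hi⟩ := hmargin (quota p n f q d P)
    (fun π' hπ' href => hP (hκ π' hπ' _ ⟨href, P, rfl⟩)) π hπ
  refine ⟨i, ?_⟩
  rw [hpr, ← sub_mul, ← mul_assoc]
  have := mul_le_mul_of_nonneg_right (hi.trans (neg_le_neg (hηδ _))) (Nat.cast_nonneg (α := ℝ) n)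
  linarith

end
end

section
/- Let Π be a closed and strictly positive set of distributions on {0,1}^p, let r be a quota rule and f a logical connection. There exist constants C > 0 and c > 0, depending only on Π, q, d, and f, such that for every n ≥ 1 for which condition κ3(n) holds, DP^min(n) ≤ C·exp(−c·n). -/
noncomputable section

/-- Every point of the convex hull of `S` is approximated by empirical means of `n` points of `S`,
with an error of the sum that is bounded uniformly in `n`. -/
theorem exists_sum_sub_nsmul_norm_le {E : Type*} [NormedAddCommGroup E] [NormedSpace ℝ E]
    {S : Set E} {x : E} (hx : x ∈ convexHull ℝ S) :
    ∃ K : ℝ, ∀ n : ℕ, ∃ v : ℕ → E, (∀ j, v j ∈ S) ∧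
      ‖∑ j ∈ Finset.range n, v j - (n : ℝ) • x‖ ≤ K := by
  refine convexHull_min (t := {x : E | ∃ K : ℝ, ∀ n : ℕ, ∃ v : ℕ → E, (∀ j, v j ∈ S) ∧
      ‖∑ j ∈ Finset.range n, v j - (n : ℝ) • x‖ ≤ K}) ?_ ?_ hx
  · intro y hy
    exact ⟨0, fun n => ⟨fun _ => y, fun _ => hy, by simp [Nat.cast_smul_eq_nsmul]⟩⟩
  · rintro y ⟨K, hK⟩ z ⟨L, hL⟩ a b ha hb hab
    refine ⟨K + L + (‖y‖ + ‖z‖), fun n => ?_⟩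
    obtain ⟨m, hmn, hm⟩ : ∃ m : ℕ, m ≤ n ∧ |(m : ℝ) - a * n| ≤ 1 := by
      have han : 0 ≤ a * (n : ℝ) := by positivity
      refine ⟨⌊a * (n : ℝ)⌋₊, Nat.floor_le_of_le ?_, ?_⟩
      · nlinarith [(Nat.cast_nonneg n : (0 : ℝ) ≤ n)]
      · have h1 := Nat.floor_le han
        have h2 := Nat.lt_floor_add_one (a * (n : ℝ))
        rw [abs_le]
        constructor <;> linarith
    obtain ⟨k, rfl⟩ := Nat.exists_eq_add_of_le hmn
    obtain ⟨v, hv, hvK⟩ := hK m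
    obtain ⟨w, hw, hwL⟩ := hL k
    refine ⟨fun j => if j < m then v j else w (j - m), fun j => ?_, ?_⟩
    · dsimp only
      split_ifs
      exacts [hv _, hw _]
    have hsum : ∑ j ∈ Finset.range (m + k), (if j < m then v j else w (j - m)) =
        ∑ j ∈ Finset.range m, v j + ∑ j ∈ Finset.range k, w j := by
      rw [Finset.sum_range_add]
      congr 1
      · exact Finset.sum_congr rfl fun j hj => if_pos (Finset.mem_range.1 hj)
      · exact Finset.sum_congr rfl fun j _ => by simp
    have hb' : b = 1 - a := by linarith
    have hdecomp : ∑ j ∈ Finset.range m, v j + ∑ j ∈ Finset.range k, w j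
          - ((m + k : ℕ) : ℝ) • (a • y + b • z) =
        (∑ j ∈ Finset.range m, v j - (m : ℝ) • y) + (∑ j ∈ Finset.range k, w j - (k : ℝ) • z)
          + ((m : ℝ) - a * ((m + k : ℕ) : ℝ)) • (y - z) := by
      subst hb'
      push_cast
      module
    rw [hsum, hdecomp]
    refine (norm_add₃_le).trans (add_le_add (add_le_add hvK hwL) ?_)
    rw [norm_smul, Real.norm_eq_abs]
    calc _ ≤ 1 * ‖y - z‖ := by gcongr
      _ ≤ _ := by rw [one_mul]; exact norm_sub_le y z

/-- The mean of `X` under the weights `w`. -/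
def wmean {Ω : Type*} [Fintype Ω] (w X : Ω → ℝ) : ℝ := ∑ ω, w ω * X ω

/-- The moment generating function of a centred variable of oscillation at most one. -/
theorem sum_mul_exp_centred_le {Ω : Type*} [Fintype Ω] {w X : Ω → ℝ} (hw : ∀ ω, 0 ≤ w ω)
    (hw1 : ∑ ω, w ω = 1) (hX : ∀ ω ω', |X ω - X ω'| ≤ 1) {t : ℝ} (ht0 : 0 ≤ t) (ht1 : t ≤ 1) :
    ∑ ω, w ω * Real.exp (t * (X ω - wmean w X)) ≤ Real.exp (t ^ 2) := by
  have hY : ∀ ω, |X ω - wmean w X| ≤ 1 := by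
    intro ω
    have h : X ω - wmean w X = ∑ ω', w ω' * (X ω - X ω') := by
      simp only [mul_sub, Finset.sum_sub_distrib, ← Finset.sum_mul, hw1, one_mul, wmean]
    rw [h]
    refine (Finset.abs_sum_le_sum_abs _ _).trans ?_
    rw [← hw1]
    refine Finset.sum_le_sum fun ω' _ => ?_
    rw [abs_mul, abs_of_nonneg (hw ω')]
    exact mul_le_of_le_one_right (hw ω') (hX ω ω')
  have hpt : ∀ ω, Real.exp (t * (X ω - wmean w X)) ≤ 1 + t * (X ω - wmean w X) + t ^ 2 := by
    intro ω
    have h1 : |t * (X ω - wmean w X)| ≤ 1 := by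
      rw [abs_mul, abs_of_nonneg ht0]
      exact mul_le_one₀ ht1 (abs_nonneg _) (hY ω)
    have h2 := (abs_le.1 (Real.abs_exp_sub_one_sub_id_le h1)).2
    have h3 : (X ω - wmean w X) ^ 2 ≤ 1 := (sq_le_one_iff_abs_le_one _).2 (hY ω)
    have h4 : (t * (X ω - wmean w X)) ^ 2 ≤ t ^ 2 := by
      rw [mul_pow]
      exact mul_le_of_le_one_right (sq_nonneg t) h3
    linarith
  calc ∑ ω, w ω * Real.exp (t * (X ω - wmean w X))
      ≤ ∑ ω, w ω * (1 + t * (X ω - wmean w X) + t ^ 2) :=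
        Finset.sum_le_sum fun ω _ => mul_le_mul_of_nonneg_left (hpt ω) (hw ω)
    _ = (1 + t ^ 2 - t * wmean w X) * ∑ ω, w ω + t * ∑ ω, w ω * X ω := by
        rw [Finset.mul_sum, Finset.mul_sum, ← Finset.sum_add_distrib]
        exact Finset.sum_congr rfl fun ω _ => by ring
    _ = t ^ 2 + 1 := by rw [hw1, wmean]; ring
    _ ≤ Real.exp (t ^ 2) := Real.add_one_le_exp _

/-- A Chernoff bound for sums of independent, non-identically distributed variables. -/
theorem sum_tail_le {Ω ι : Type*} [Fintype Ω] [Fintype ι] [DecidableEq ι]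
    {w : ι → Ω → ℝ} {X : Ω → ℝ}
    (hw : ∀ j ω, 0 ≤ w j ω) (hw1 : ∀ j, ∑ ω, w j ω = 1) (hX : ∀ ω ω', |X ω - X ω'| ≤ 1)
    {t : ℝ} (ht0 : 0 ≤ t) (ht1 : t ≤ 1) (a : ℝ) :
    ∑ P : ι → Ω, (if a ≤ ∑ j, X (P j) - ∑ j, wmean (w j) X then ∏ j, w j (P j) else 0) ≤
      Real.exp (t ^ 2 * Fintype.card ι - t * a) := by
  calc _ ≤ ∑ P : ι → Ω, Real.exp (-(t * a)) *
          ∏ j, (w j (P j) * Real.exp (t * (X (P j) - wmean (w j) X))) := by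
        refine Finset.sum_le_sum fun P _ => ?_
        have hprod : 0 ≤ ∏ j, w j (P j) := Finset.prod_nonneg fun j _ => hw j _
        rw [Finset.prod_mul_distrib, ← Real.exp_sum, ← Finset.mul_sum, Finset.sum_sub_distrib,
          mul_left_comm, ← Real.exp_add]
        split_ifs with h
        · refine le_mul_of_one_le_right hprod (Real.one_le_exp ?_)
          nlinarith
        · positivity
    _ = Real.exp (-(t * a)) * ∏ j, ∑ ω, w j ω * Real.exp (t * (X ω - wmean (w j) X)) := by
        rw [← Finset.mul_sum, Finset.prod_univ_sum, Fintype.piFinset_univ]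
    _ ≤ Real.exp (-(t * a)) * ∏ _j : ι, Real.exp (t ^ 2) := by
        gcongr with j
        · exact fun j _ => Finset.sum_nonneg fun ω _ => mul_nonneg (hw j ω) (Real.exp_pos _).le
        · exact sum_mul_exp_centred_le (hw j) (hw1 j) hX ht0 ht1
    _ = _ := by
        rw [← Real.exp_sum, ← Real.exp_add, Finset.sum_const, nsmul_eq_mul, Finset.card_univ]
        ring_nf

/-- The indicator of `Ω_i`. -/
def omegaInd (p : ℕ) (f : Judg p → Bool) (i : Fin (p + 1)) (ω : Judg p) : ℝ :=
  if ω ∈ Omega p f i then 1 else 0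

theorem abs_omegaInd_sub_le (p : ℕ) (f : Judg p → Bool) (i : Fin (p + 1)) (ω ω' : Judg p) :
    |omegaInd p f i ω - omegaInd p f i ω'| ≤ 1 := by
  unfold omegaInd
  split_ifs <;> norm_num

theorem nOnes_eq_sum_omegaInd (p n : ℕ) (f : Judg p → Bool) (P : Fin n → Judg p)
    (i : Fin (p + 1)) : (nOnes p n f P i : ℝ) = ∑ j, omegaInd p f i (P j) := by
  simp only [nOnes, Hist, Finset.card_filter, omegaInd]
  push_cast
  rw [Finset.sum_comm]
  exact Finset.sum_congr rfl fun j _ => by rw [Finset.sum_ite_eq]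

theorem wmean_omegaInd (p : ℕ) (f : Judg p → Bool) (w : Judg p → ℝ) (i : Fin (p + 1)) :
    wmean w (omegaInd p f i) = pr p f w i := by
  simp [wmean, omegaInd, pr]

theorem wmean_neg {Ω : Type*} [Fintype Ω] (w X : Ω → ℝ) :
    wmean w (fun ω => -X ω) = -wmean w X := by
  simp [wmean]

theorem probParadox_nonneg {p n : ℕ} {f : Judg p → Bool} {q : Fin (p + 1) → ℝ}
    {d : Fin (p + 1) → Bool} {v : Fin n → Judg p → ℝ} (hv : ∀ j, IsDistribution p (v j)) :
    0 ≤ probParadox p n f q d v := by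
  unfold probParadox
  refine Finset.sum_nonneg fun P _ => ?_
  split_ifs
  exacts [Finset.prod_nonneg fun j _ => (hv j).1 _, le_rfl]

theorem DPmin_le_probParadox {p n : ℕ} {f : Judg p → Bool} {q : Fin (p + 1) → ℝ}
    {d : Fin (p + 1) → Bool} {D : Set (Judg p → ℝ)} (hdist : ∀ π ∈ D, IsDistribution p π)
    {v : Fin n → Judg p → ℝ} (hv : ∀ j, v j ∈ D) :
    DPmin p n f q d D ≤ probParadox p n f q d v := by
  refine csInf_le ⟨0, ?_⟩ ⟨v, hv, rfl⟩
  rintro x ⟨u, hu, rfl⟩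
  exact probParadox_nonneg fun j => hdist _ (hu j)

/-- A profile on which the quota rule disagrees with its value on `π` at an untied proposition
has a count that deviates linearly from the one expected under `π`. -/
theorem deviation_of_quota_ne {p n : ℕ} {f : Judg p → Bool} {q : Fin (p + 1) → ℝ}
    {d : Fin (p + 1) → Bool} {π : Judg p → ℝ} {P : Fin n → Judg p} {i : Fin (p + 1)}
    (htie : pr p f π i ≠ q i) (h : quota p n f q d P i ≠ quotaDist p f q d π i) {δ : ℝ}
    (hδ : δ ≤ |pr p f π i - q i|) :
    δ * n ≤ nOnes p n f P i - n * pr p f π i ∨ δ * n ≤ n * pr p f π i - nOnes p n f P i := by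
  have hn : (0 : ℝ) ≤ n := Nat.cast_nonneg n
  unfold quota quotaDist at h
  rcases lt_or_gt_of_ne htie with hlt | hgt
  · left
    rw [abs_of_neg (by linarith)] at hδ
    have : q i * n ≤ nOnes p n f P i := by
      by_contra! hc
      simp [not_lt_of_gt hlt, hlt.ne, not_lt_of_gt hc, hc.ne] at h
    nlinarith
  · right
    rw [abs_of_pos (by linarith)] at hδ
    have : (nOnes p n f P i : ℝ) ≤ q i * n := by
      by_contra! hc
      simp [hgt, hc] at h
    nlinarith

/-- If all effective refinements of `π` at `n` are consistent, then every paradoxical profile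
disagrees with `π` at some untied proposition. -/
theorem Paradox.exists_quota_ne {p n : ℕ} {f : Judg p → Bool} {q : Fin (p + 1) → ℝ}
    {d : Fin (p + 1) → Bool} {π : Judg p → ℝ}
    (hπ : ∀ α : Fin (p + 1) → Bool, EffRef p n f q d π α → Consistent p f α)
    {P : Fin n → Judg p} (hP : Paradox p n f q d P) :
    ∃ i, pr p f π i ≠ q i ∧ quota p n f q d P i ≠ quotaDist p f q d π i := by
  by_contra! hc
  exact hP (hπ _ ⟨hc, P, rfl⟩)

/-- Distance of `π` from the thresholds at the untied propositions. -/
theorem exists_untied_gap (p : ℕ) (f : Judg p → Bool) (q : Fin (p + 1) → ℝ) (π : Judg p → ℝ) :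
    ∃ δ : ℝ, 0 < δ ∧ δ ≤ 1 ∧ ∀ i, pr p f π i ≠ q i → δ ≤ |pr p f π i - q i| := by
  classical
  let g : Fin (p + 1) → ℝ := fun i =>
    if pr p f π i = q i then 1 else min 1 |pr p f π i - q i|
  obtain ⟨i₀, hi₀⟩ := Finite.exists_min g
  refine ⟨g i₀, ?_, ?_, fun i hi => ?_⟩
  · dsimp only [g]
    split_ifs with h
    exacts [one_pos, lt_min one_pos (abs_pos.2 (sub_ne_zero.2 h))]
  · dsimp only [g]
    split_ifs
    exacts [le_rfl, min_le_left _ _]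
  · refine (hi₀ i).trans ?_
    simp only [g, if_neg hi]
    exact min_le_right _ _

/-- The exponential bound for one fixed point of the convex hull. -/
theorem exists_DPmin_le_of_mem_convexHull {p : ℕ} (f : Judg p → Bool) (q : Fin (p + 1) → ℝ)
    (d : Fin (p + 1) → Bool) {D : Set (Judg p → ℝ)} (hdist : ∀ π ∈ D, IsDistribution p π)
    {π : Judg p → ℝ} (hπ : π ∈ convexHull ℝ D) :
    ∃ C > (0 : ℝ), ∃ c > (0 : ℝ), ∀ n : ℕ,
      (∀ α : Fin (p + 1) → Bool, EffRef p n f q d π α → Consistent p f α) →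
      DPmin p n f q d D ≤ C * Real.exp (-c * (n : ℝ)) := by
  classical
  obtain ⟨K, hK⟩ := exists_sum_sub_nsmul_norm_le hπ
  obtain ⟨δ, hδ0, hδ1, hδ⟩ := exists_untied_gap p f q π
  set M : ℝ := Fintype.card (Judg p) * K
  refine ⟨(p + 1) * (2 * Real.exp (δ / 2 * M)), by positivity, δ ^ 2 / 4, by positivity,
    fun n hcons => ?_⟩
  obtain ⟨u, huD, hu⟩ := hK n
  let v : Fin n → Judg p → ℝ := fun j => u j
  have hv : ∀ j, IsDistribution p (v j) := fun j => hdist _ (huD j)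
  have hK0 : 0 ≤ K := (norm_nonneg _).trans hu
  have hmean : ∀ i, |∑ j, pr p f (v j) i - n * pr p f π i| ≤ M := by
    intro i
    have h1 : ∑ j, pr p f (v j) i - n * pr p f π i =
        ∑ ω ∈ Omega p f i, (∑ j ∈ Finset.range n, u j - (n : ℝ) • π) ω := by
      simp only [pr, v, Pi.sub_apply, Finset.sum_apply, Pi.smul_apply, smul_eq_mul,
        Finset.sum_sub_distrib, Finset.mul_sum]
      rw [Finset.sum_comm]
      simp only [Finset.sum_range]
    rw [h1]
    calc _ ≤ ∑ ω ∈ Omega p f i, |(∑ j ∈ Finset.range n, u j - (n : ℝ) • π) ω| :=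
          Finset.abs_sum_le_sum_abs _ _
      _ ≤ ∑ _ω ∈ Omega p f i, K := Finset.sum_le_sum fun ω _ => (norm_le_pi_norm _ ω).trans hu
      _ ≤ M := by
          rw [Finset.sum_const, nsmul_eq_mul]
          exact mul_le_mul_of_nonneg_right (by exact_mod_cast Finset.card_le_univ _) hK0
  have htail : ∀ X : Judg p → ℝ, (∀ ω ω', |X ω - X ω'| ≤ 1) →
      ∑ P : Fin n → Judg p, (if δ * n - M ≤ ∑ j, X (P j) - ∑ j, wmean (v j) X
        then ∏ j, v j (P j) else 0) ≤ Real.exp (δ / 2 * M) * Real.exp (-(δ ^ 2 / 4) * n) := by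
    intro X hX
    refine (sum_tail_le (fun j => (hv j).1) (fun j => (hv j).2) hX (t := δ / 2) (by positivity)
      (by linarith) _).trans_eq ?_
    rw [← Real.exp_add, Fintype.card_fin]
    ring_nf
  let Y : Fin (p + 1) → Judg p → ℝ := fun i ω => -omegaInd p f i ω
  have hY : ∀ i ω ω', |Y i ω - Y i ω'| ≤ 1 := by
    intro i ω ω'
    have := abs_omegaInd_sub_le p f i ω' ω
    simpa only [Y, neg_sub_neg] using this
  let T : (Judg p → ℝ) → (Fin n → Judg p) → ℝ := fun X P =>
    if δ * n - M ≤ ∑ j, X (P j) - ∑ j, wmean (v j) X then ∏ j, v j (P j) else 0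
  have hw : ∀ P : Fin n → Judg p, 0 ≤ ∏ j, v j (P j) := fun P =>
    Finset.prod_nonneg fun j _ => (hv j).1 _
  have hT : ∀ X P, 0 ≤ T X P := by
    intro X P
    dsimp only [T]
    split_ifs
    exacts [hw P, le_rfl]
  have hpt : ∀ P : Fin n → Judg p, (if Paradox p n f q d P then ∏ j, v j (P j) else 0) ≤
      ∑ i, (T (omegaInd p f i) P + T (Y i) P) := by
    intro P
    have hnn : ∀ i, 0 ≤ T (omegaInd p f i) P + T (Y i) P := fun i => add_nonneg (hT _ _) (hT _ _)
    split_ifs with hP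
    · obtain ⟨i, htie, hne⟩ := hP.exists_quota_ne hcons
      refine le_trans ?_ (Finset.single_le_sum (fun i _ => hnn i) (Finset.mem_univ i))
      have hm := abs_le.1 (hmean i)
      rcases deviation_of_quota_ne htie hne (hδ i htie) with h | h
      · refine le_add_of_le_of_nonneg ?_ (hT _ _)
        dsimp only [T]
        rw [if_pos]
        simp only [wmean_omegaInd, ← nOnes_eq_sum_omegaInd]
        linarith
      · refine le_add_of_nonneg_of_le (hT _ _) ?_
        dsimp only [T]
        rw [if_pos]
        simp only [Y, wmean_neg, Finset.sum_neg_distrib, wmean_omegaInd, ← nOnes_eq_sum_omegaInd]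
        linarith
    · exact Finset.sum_nonneg fun i _ => hnn i
  calc DPmin p n f q d D ≤ probParadox p n f q d v := DPmin_le_probParadox hdist fun j => huD j
    _ = ∑ P : Fin n → Judg p, if Paradox p n f q d P then ∏ j, v j (P j) else 0 := by
        unfold probParadox
        exact Finset.sum_congr rfl fun P _ => by congr
    _ ≤ ∑ P, ∑ i, (T (omegaInd p f i) P + T (Y i) P) := Finset.sum_le_sum fun P _ => hpt P
    _ = ∑ i, (∑ P, T (omegaInd p f i) P + ∑ P, T (Y i) P) := by
        rw [Finset.sum_comm]
        simp only [Finset.sum_add_distrib]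
    _ ≤ ∑ _i : Fin (p + 1), (Real.exp (δ / 2 * M) * Real.exp (-(δ ^ 2 / 4) * n) +
          Real.exp (δ / 2 * M) * Real.exp (-(δ ^ 2 / 4) * n)) :=
        Finset.sum_le_sum fun i _ =>
          add_le_add (htail _ (abs_omegaInd_sub_le p f i)) (htail _ (hY i))
    _ = _ := by
        rw [Finset.sum_const, Finset.card_univ, Fintype.card_fin, nsmul_eq_mul]
        push_cast
        ring

/-- there are constants `C, c > 0` such that whenever κ3(n) holds,
`DP^min(n) ≤ C·exp(−c·n)`. -/
theorem stmt_16 (p : ℕ) (hp : 1 ≤ p) (f : Judg p → Bool)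
    (q : Fin (p + 1) → ℝ) (hq : ∀ i, q i ∈ Set.Icc (0 : ℝ) 1)
    (d : Fin (p + 1) → Bool) (D : Set (Judg p → ℝ)) (hne : D.Nonempty)
    (hcl : IsClosed D) (hsp : StrictlyPositive p D)
    (hdist : ∀ π ∈ D, IsDistribution p π) :
    ∃ C > (0 : ℝ), ∃ c > (0 : ℝ), ∀ n : ℕ, 1 ≤ n → kappa3 p n f q d D →
      DPmin p n f q d D ≤ C * Real.exp (-c * (n : ℝ)) := by
  classical
  -- Effective refinements of `π` depend only on its pattern, and there are finitely many patterns.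
  let pat : (Judg p → ℝ) → Fin (p + 1) → Prop × Bool := fun π i =>
    (pr p f π i = q i, quotaDist p f q d π i)
  have key : ∀ τ : Fin (p + 1) → Prop × Bool, ∃ C > (0 : ℝ), ∃ c > (0 : ℝ), ∀ n : ℕ,
      (∃ π ∈ convexHull ℝ D, pat π = τ ∧
        ∀ α : Fin (p + 1) → Bool, EffRef p n f q d π α → Consistent p f α) →
      DPmin p n f q d D ≤ C * Real.exp (-c * (n : ℝ)) := by
    intro τ
    by_cases hτ : ∃ π ∈ convexHull ℝ D, pat π = τ
    · obtain ⟨π₀, hπ₀, hpat₀⟩ := hτ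
      obtain ⟨C, hC, c, hc, hb⟩ := exists_DPmin_le_of_mem_convexHull f q d hdist hπ₀
      refine ⟨C, hC, c, hc, fun n ⟨π, _, hpat, hcons⟩ => hb n fun α hα => hcons α ⟨?_, hα.2⟩⟩
      intro i hi
      have hi' := congrFun (hpat.trans hpat₀.symm) i
      simp only [pat, Prod.mk.injEq] at hi'
      rw [hi'.2]
      exact hα.1 i fun h => hi (hi'.1 ▸ h)
    · exact ⟨1, one_pos, 1, one_pos, fun n ⟨π, hπ, hpat, _⟩ => (hτ ⟨π, hπ, hpat⟩).elim⟩
  choose C hC c hc hb using key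
  obtain ⟨τC, hτC⟩ := Finite.exists_max C
  obtain ⟨τc, hτc⟩ := Finite.exists_min c
  refine ⟨C τC, hC _, c τc, hc _, fun n _ ⟨π, hπ, hcons⟩ => ?_⟩
  refine (hb (pat π) n ⟨π, hπ, rfl, hcons⟩).trans ?_
  have h1 := hτc (pat π)
  have h2 := hC τC
  gcongr
  exact hτC _

end
end
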